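/- Let g(x) = -log|x| on ℝ² and V(x) = |x|². Then the probability measure μ = (1/π) 1_{B₁}(x) dx, the normalized Lebesgue measure on the closed unit disk B₁ ⊂ ℝ², is the unique minimizer of I_V(μ) = ∬ g(x-y) dμ(x)dμ(y) + ∫ V dμ over Borel probability measures on ℝ² (the circle law). -/

import Mathlib

open MeasureTheory Filter Topology
open scoped ENNReal Real

noncomputable section

/-- The plane `ℝ²`. -/
abbrev Plane := EuclideanSpace ℝ (Fin 2)

open scoped Classical in
/-- The two-dimensional logarithmic (Coulomb) kernel `g(x) = -log|x|`, with value `+∞`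
at the origin, viewed in the extended reals. -/
def logK2 (x : Plane) : EReal := if x = 0 then ⊤ else ((- Real.log ‖x‖ : ℝ) : EReal)

/-- The integral of an extended-real-valued function, defined as the (extended-real)
difference of the integrals of the positive and negative parts. -/
def eIntE {α : Type*} [MeasurableSpace α] (μ : Measure α) (f : α → EReal) : EReal :=
  ((∫⁻ x, (if f x = ⊤ then ⊤ else ENNReal.ofReal (f x).toReal) ∂μ : ℝ≥0∞) : EReal)
    - ((∫⁻ x, (if f x = ⊥ then ⊤ else ENNReal.ofReal (-(f x)).toReal) ∂μ : ℝ≥0∞) : EReal)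

/-- The energy functional `I_V(μ) = ∬ g(x-y) dμ(x)dμ(y) + ∫ V dμ` for the logarithmic
kernel in the plane, written (as is standard to make it well defined for all probability
measures) as the double integral `∬ [g(x-y) + V(x)/2 + V(y)/2] dμ(x) dμ(y)`. -/
def Ilog2 (V : Plane → ℝ) (μ : Measure Plane) : EReal :=
  eIntE (μ.prod μ)
    (fun p => logK2 (p.1 - p.2) + ((V p.1 / 2 + V p.2 / 2 : ℝ) : EReal))

/-- The circle law: the normalized Lebesgue measure `(1/π) 1_{B₁} dx` on the closed unit
disk of `ℝ²`. -/
def circleLaw : Measure Plane :=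
  (ENNReal.ofReal π)⁻¹ • (volume.restrict (Metric.closedBall (0 : Plane) 1))

/-- Minus the logarithmic potential of the circle law, as a function of the distance to the
origin. -/
def diskLogPotential (s : ℝ) : ℝ := if s ≤ 1 then (s ^ 2 - 1) / 2 else Real.log s

lemma polarCoord_symm_eq_circleMap (r θ : ℝ) :
    Complex.polarCoord.symm (r, θ) = circleMap 0 r θ := by
  rw [Complex.polarCoord_symm_apply, circleMap_zero, Complex.exp_mul_I]
  simp

lemma integrableOn_log_norm_polarCoord_symm_sub (a : ℂ) (r : ℝ) :
    IntegrableOn (fun θ => Real.log ‖Complex.polarCoord.symm (r, θ) - a‖)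
      (Set.Ioo (-π) π) := by
  have h := circleIntegrable_log_norm_sub_const (a := a) (c := 0) r
  have h2 : IntervalIntegrable (fun θ : ℝ => Real.log ‖circleMap 0 r θ - a‖) volume (-π) π := by
    have hp : Function.Periodic (fun θ : ℝ => Real.log ‖circleMap 0 r θ - a‖) (2 * π) := by
      intro θ
      simp only [periodic_circleMap 0 r θ]
    exact hp.intervalIntegrable₀ Real.two_pi_pos.ne' h _ _
  rw [intervalIntegrable_iff_integrableOn_Ioo_of_le (by linarith [Real.pi_pos])] at h2
  simpa only [polarCoord_symm_eq_circleMap] using h2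

lemma integral_log_norm_polarCoord_symm_sub (a : ℂ) {r : ℝ} (hr : 0 < r) :
    ∫ θ in Set.Ioo (-π) π, Real.log ‖Complex.polarCoord.symm (r, θ) - a‖ =
      2 * π * (Real.log r + Real.posLog (r⁻¹ * ‖a‖)) := by
  have h := circleAverage_log_norm_sub_const_eq_log_radius_add_posLog (c := 0) (a := a) hr.ne'
  have hp : Function.Periodic (fun θ : ℝ => Real.log ‖circleMap 0 r θ - a‖) (2 * π) := by
    intro θ
    simp only [periodic_circleMap 0 r θ]
  have h2 := hp.intervalIntegral_add_eq 0 (-π)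
  rw [show -π + 2 * π = π by ring, zero_add,
    intervalIntegral.integral_of_le (by linarith [Real.pi_pos] : -π ≤ π),
    integral_Ioc_eq_integral_Ioo] at h2
  simp only [polarCoord_symm_eq_circleMap]
  rw [← h2]
  rw [Real.circleAverage, smul_eq_mul, zero_sub, norm_neg] at h
  rw [← h]
  field_simp

lemma integral_mul_log_add_posLog {s : ℝ} (hs : 0 ≤ s) :
    IntervalIntegrable (fun r => r * (Real.log r + Real.posLog (r⁻¹ * s))) volume 0 1 ∧
    ∫ r in (0:ℝ)..1, r * (Real.log r + Real.posLog (r⁻¹ * s)) = diskLogPotential s / 2 := by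
  have small : ∀ r, 0 < r → r ≤ s → r * (Real.log r + Real.posLog (r⁻¹ * s)) = r * Real.log s := by
    intro r h0 hr
    have h1 : 1 ≤ r⁻¹ * s := by
      rw [inv_mul_eq_div, one_le_div h0]; exact hr
    rw [Real.posLog_eq_log (by rw [abs_of_pos (by linarith)]; exact h1),
      Real.log_mul (by positivity) (by linarith), Real.log_inv]
    ring
  have large : ∀ r, 0 < r → s ≤ r → r * (Real.log r + Real.posLog (r⁻¹ * s)) = r * Real.log r := by
    intro r h0 hr
    rw [Real.posLog_eq_zero_iff _ |>.2, add_zero]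
    rw [abs_of_nonneg (by positivity), inv_mul_eq_div, div_le_one h0]; exact hr
  have int_small : ∀ t, 0 ≤ t → t ≤ s →
      IntervalIntegrable (fun r => r * (Real.log r + Real.posLog (r⁻¹ * s))) volume 0 t ∧
      ∫ r in (0:ℝ)..t, r * (Real.log r + Real.posLog (r⁻¹ * s)) = t ^ 2 / 2 * Real.log s := by
    intro t ht hts
    have he : Set.EqOn (fun r => r * Real.log s)
        (fun r => r * (Real.log r + Real.posLog (r⁻¹ * s))) (Set.uIoc 0 t) := by
      intro r hr
      rw [Set.uIoc_of_le ht] at hr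
      exact (small r hr.1 (hr.2.trans hts)).symm
    refine ⟨(IntervalIntegrable.congr he (Continuous.intervalIntegrable (by fun_prop) _ _)), ?_⟩
    rw [← intervalIntegral.integral_congr_ae (.of_forall he)]
    rw [intervalIntegral.integral_mul_const, integral_id]
    ring
  rcases le_or_gt s 1 with h | h
  · obtain ⟨i1, e1⟩ := int_small s hs le_rfl
    have he : Set.EqOn (fun r => r * Real.log r)
        (fun r => r * (Real.log r + Real.posLog (r⁻¹ * s))) (Set.uIoc s 1) := by
      intro r hr
      rw [Set.uIoc_of_le h] at hr
      exact (large r (hs.trans_lt hr.1) hr.1.le).symm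
    have i0 : IntervalIntegrable (fun r => r * Real.log r) volume s 1 :=
      Real.continuous_mul_log.intervalIntegrable _ _
    have i2 := i0.congr he
    refine ⟨i1.trans i2, ?_⟩
    rw [← intervalIntegral.integral_add_adjacent_intervals i1 i2, e1,
      ← intervalIntegral.integral_congr_ae (.of_forall he)]
    have : ∫ r in s..1, r * Real.log r =
        (1 ^ 2 / 2 * Real.log 1 - 1 ^ 2 / 4) - (s ^ 2 / 2 * Real.log s - s ^ 2 / 4) := by
      refine intervalIntegral.integral_eq_sub_of_hasDerivAt_of_le
        (f := fun r => r ^ 2 / 2 * Real.log r - r ^ 2 / 4) h ?_ ?_ i0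
      · apply Continuous.continuousOn
        have : (fun r : ℝ => r ^ 2 / 2 * Real.log r - r ^ 2 / 4) =
            fun r => r / 2 * (r * Real.log r) - r ^ 2 / 4 := by ext; ring
        rw [this]
        have := Real.continuous_mul_log
        fun_prop
      · intro r hr
        have hr0 : r ≠ 0 := (hs.trans_lt hr.1).ne'
        have hd : HasDerivAt (fun r => r ^ 2 / 2 * Real.log r - r ^ 2 / 4) _ r :=
          (((hasDerivAt_pow 2 r).div_const 2).mul (Real.hasDerivAt_log hr0)).sub
            ((hasDerivAt_pow 2 r).div_const 4)
        refine hd.congr_deriv ?_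
        field_simp
        norm_num
        ring
    rw [this, diskLogPotential, if_pos h]
    simp
    ring
  · obtain ⟨i1, e1⟩ := int_small 1 zero_le_one h.le
    refine ⟨i1, ?_⟩
    rw [e1, diskLogPotential, if_neg h.not_ge]
    ring

lemma lintegral_closedBall_sub_log_norm_sub (a : ℂ) {C : ℝ} (hC : Real.log (1 + ‖a‖) ≤ C) :
    ∫⁻ z in Metric.closedBall (0 : ℂ) 1, ENNReal.ofReal (C - Real.log ‖z - a‖) =
      ENNReal.ofReal (π * (C - diskLogPotential ‖a‖)) := by
  have hnn : ∀ z ∈ Metric.closedBall (0 : ℂ) 1, 0 ≤ C - Real.log ‖z - a‖ := by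
    intro z hz
    rw [mem_closedBall_zero_iff] at hz
    have h1 : ‖z - a‖ ≤ 1 + ‖a‖ := (norm_sub_le _ _).trans (by linarith)
    rcases (norm_nonneg (z - a)).eq_or_lt with h | h
    · rw [← h, Real.log_zero]
      have := Real.log_nonneg (show 1 ≤ 1 + ‖a‖ by linarith [norm_nonneg a])
      linarith
    · linarith [Real.log_le_log h h1]
  have hm : Measurable fun z : ℂ => ENNReal.ofReal (C - Real.log ‖z - a‖) := by fun_prop
  rw [← lintegral_indicator measurableSet_closedBall, ← Complex.lintegral_comp_polarCoord_symm,
    polarCoord_target, Measure.volume_eq_prod, ← Measure.prod_restrict, lintegral_prod]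
  swap
  · apply Measurable.aemeasurable
    have h1 : Measurable fun p : ℝ × ℝ => (Complex.polarCoord.symm p : ℂ) := by
      simp only [Complex.polarCoord_symm_apply]
      fun_prop
    exact (by fun_prop : Measurable fun p : ℝ × ℝ => ENNReal.ofReal p.1).smul
      ((hm.indicator measurableSet_closedBall).comp h1)
  obtain ⟨hi, he⟩ := integral_mul_log_add_posLog (norm_nonneg a)
  have key : ∀ r ∈ Set.Ioi (0 : ℝ), ∫⁻ θ in Set.Ioo (-π) π, ENNReal.ofReal r •
      (Metric.closedBall (0 : ℂ) 1).indicator (fun z => ENNReal.ofReal (C - Real.log ‖z - a‖))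
        (Complex.polarCoord.symm (r, θ)) =
      (Set.Iic (1 : ℝ)).indicator (fun r => ENNReal.ofReal
        (2 * π * (r * C - r * (Real.log r + Real.posLog (r⁻¹ * ‖a‖))))) r := by
    intro r hr
    have hr : 0 < r := hr
    by_cases h1 : r ≤ 1
    · have hmem : ∀ θ, (Complex.polarCoord.symm (r, θ) : ℂ) ∈ Metric.closedBall (0 : ℂ) 1 := by
        intro θ
        rw [mem_closedBall_zero_iff, Complex.norm_polarCoord_symm, abs_of_pos hr]
        exact h1
      simp only [Set.indicator_of_mem (hmem _), Set.indicator_of_mem (Set.mem_Iic.2 h1),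
        smul_eq_mul]
      have hint := integrableOn_log_norm_polarCoord_symm_sub a r
      have hconst : IntegrableOn (fun _ : ℝ => C) (Set.Ioo (-π) π) := by
        simp [integrableOn_const_iff]
      have hsub : IntegrableOn (fun θ => C - Real.log ‖Complex.polarCoord.symm (r, θ) - a‖)
          (Set.Ioo (-π) π) := hconst.sub hint
      rw [lintegral_const_mul', ← ofReal_integral_eq_lintegral_ofReal hsub
        (.of_forall fun θ => hnn _ (hmem θ)), integral_sub hconst hint,
        integral_log_norm_polarCoord_symm_sub a hr, ← ENNReal.ofReal_mul hr.le]
      · congr 1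
        simp [Real.volume_real_Ioo_of_le (show -π ≤ π by linarith [Real.pi_pos])]
        ring
      · simp
    · have hmem : ∀ θ, (Complex.polarCoord.symm (r, θ) : ℂ) ∉ Metric.closedBall (0 : ℂ) 1 := by
        intro θ
        rw [mem_closedBall_zero_iff, Complex.norm_polarCoord_symm, abs_of_pos hr]
        exact h1
      simp only [Set.indicator_of_notMem (hmem _),
        Set.indicator_of_notMem (show r ∉ Set.Iic 1 from h1), smul_zero, lintegral_zero]
  rw [setLIntegral_congr_fun measurableSet_Ioi key, lintegral_indicator measurableSet_Iic,
    Measure.restrict_restrict measurableSet_Iic, Set.inter_comm, Set.Ioi_inter_Iic]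
  rw [intervalIntegrable_iff_integrableOn_Ioc_of_le zero_le_one] at hi
  have hi' : IntegrableOn (fun r : ℝ => r * C) (Set.Ioc 0 1) := by
    rw [← intervalIntegrable_iff_integrableOn_Ioc_of_le zero_le_one]
    exact Continuous.intervalIntegrable (by fun_prop) _ _
  rw [intervalIntegral.integral_of_le zero_le_one] at he
  have hsub : IntegrableOn
      (fun r => 2 * π * (r * C - r * (Real.log r + Real.posLog (r⁻¹ * ‖a‖)))) (Set.Ioc 0 1) :=
    (hi'.sub hi).const_mul _
  rw [← ofReal_integral_eq_lintegral_ofReal hsub]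
  · congr 1
    rw [integral_const_mul]
    rw [integral_sub hi' hi, he, ← intervalIntegral.integral_of_le zero_le_one,
      intervalIntegral.integral_mul_const, integral_id]
    ring
  · refine (ae_restrict_iff' measurableSet_Ioc).2 (.of_forall fun r hr => ?_)
    have h0 : 0 < r := hr.1
    have hlog : Real.log r + Real.posLog (r⁻¹ * ‖a‖) ≤ C := by
      refine le_trans ?_ hC
      have := norm_nonneg a
      rw [Real.posLog_eq_log_max_one (by positivity), ← Real.log_mul h0.ne' (by positivity)]
      refine Real.log_le_log (by positivity) ?_
      rw [mul_max_of_nonneg _ _ h0.le, mul_inv_cancel_left₀ h0.ne']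
      exact max_le (by linarith [hr.2]) (by linarith)
    have : 0 ≤ r * (C - (Real.log r + Real.posLog (r⁻¹ * ‖a‖))) :=
      mul_nonneg h0.le (by linarith)
    have h2 : 0 ≤ 2 * π * (r * (C - (Real.log r + Real.posLog (r⁻¹ * ‖a‖)))) :=
      mul_nonneg (by positivity) this
    simpa [mul_sub] using h2

lemma isProbabilityMeasure_circleLaw : IsProbabilityMeasure circleLaw := by
  constructor
  rw [circleLaw, Measure.smul_apply, Measure.restrict_apply_univ,
    EuclideanSpace.volume_closedBall_fin_two, smul_eq_mul]
  rw [ENNReal.ofReal_one, one_pow, one_mul, ENNReal.inv_mul_cancel]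
  · simpa using Real.pi_pos
  · simp

lemma lintegral_circleLaw_sub_log_norm_sub (x : Plane) {C : ℝ} (hC : Real.log (1 + ‖x‖) ≤ C) :
    ∫⁻ y, ENNReal.ofReal (C - Real.log ‖y - x‖) ∂circleLaw =
      ENNReal.ofReal (C - diskLogPotential ‖x‖) := by
  let e := Complex.orthonormalBasisOneI.repr
  have hmp := e.measurePreserving
  have h := lintegral_closedBall_sub_log_norm_sub (e.symm x) (C := C) (by simpa using hC)
  have hpre : e ⁻¹' Metric.closedBall (0 : Plane) 1 = Metric.closedBall 0 1 := by
    ext z; simp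
  rw [circleLaw, lintegral_smul_measure, ← hmp.setLIntegral_comp_preimage measurableSet_closedBall
    (by fun_prop), hpre]
  have : ∀ z, ‖e z - x‖ = ‖z - e.symm x‖ := by
    intro z
    rw [← e.norm_map (z - e.symm x), map_sub, e.apply_symm_apply]
  simp only [this]
  rw [h, e.symm.norm_map, ENNReal.ofReal_mul Real.pi_pos.le, smul_eq_mul, ← mul_assoc,
    ENNReal.inv_mul_cancel, one_mul]
  · simpa using Real.pi_pos
  · simp

lemma diskLogPotential_le_sq {s : ℝ} (hs : 0 ≤ s) : diskLogPotential s ≤ (s ^ 2 - 1) / 2 := by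
  rw [diskLogPotential]
  split_ifs with h
  · rfl
  · have := Real.log_le_sub_one_of_pos (show 0 < s ^ 2 by nlinarith)
    rw [Real.log_pow] at this
    push_cast at this
    linarith

lemma neg_half_le_diskLogPotential {s : ℝ} : -(1 / 2) ≤ diskLogPotential s := by
  rw [diskLogPotential]
  split_ifs with h
  · nlinarith [sq_nonneg s]
  · linarith [Real.log_nonneg (not_le.1 h).le]

lemma diskLogPotential_le_log {s : ℝ} (hs : 0 ≤ s) : diskLogPotential s ≤ Real.log (1 + s) := by
  rw [diskLogPotential]
  split_ifs with h
  · nlinarith [Real.log_nonneg (show 1 ≤ 1 + s by linarith)]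
  · exact Real.log_le_log (by linarith) (by linarith)

lemma measurable_diskLogPotential : Measurable diskLogPotential :=
  Measurable.ite measurableSet_Iic (by fun_prop) (by fun_prop)

lemma ae_circleLaw_norm_le_one : ∀ᵐ x ∂circleLaw, ‖x‖ ≤ 1 := by
  refine Measure.ae_smul_measure ?_ _
  filter_upwards [ae_restrict_mem measurableSet_closedBall] with x hx
  simpa using hx

lemma log_norm_sub_le_log_one_add {x y : Plane} (hy : ‖y‖ ≤ 1) :
    Real.log ‖y - x‖ ≤ Real.log (1 + ‖x‖) := by
  have h1 : ‖y - x‖ ≤ 1 + ‖x‖ := (norm_sub_le _ _).trans (by linarith)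
  rcases (norm_nonneg (y - x)).eq_or_lt with h | h
  · rw [← h, Real.log_zero]
    exact Real.log_nonneg (show 1 ≤ 1 + ‖x‖ by linarith [norm_nonneg x])
  · exact Real.log_le_log h h1

lemma integral_circleLaw_log_norm_sub (x : Plane) :
    Integrable (fun y => Real.log ‖y - x‖) circleLaw ∧
      ∫ y, Real.log ‖y - x‖ ∂circleLaw = diskLogPotential ‖x‖ := by
  have := isProbabilityMeasure_circleLaw
  set C := Real.log (1 + ‖x‖)
  have h := lintegral_circleLaw_sub_log_norm_sub x (C := C) le_rfl
  have hm : Measurable fun y : Plane => C - Real.log ‖y - x‖ := by fun_prop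
  have hnn : 0 ≤ᵐ[circleLaw] fun y => C - Real.log ‖y - x‖ := by
    filter_upwards [ae_circleLaw_norm_le_one] with y hy
    exact sub_nonneg.2 (log_norm_sub_le_log_one_add hy)
  have hi : Integrable (fun y => C - Real.log ‖y - x‖) circleLaw := by
    refine (lintegral_ofReal_ne_top_iff_integrable hm.aestronglyMeasurable hnn).1 ?_
    rw [h]
    exact ENNReal.ofReal_ne_top
  have hi' : Integrable (fun y => Real.log ‖y - x‖) circleLaw := by
    simpa [Pi.sub_def] using (integrable_const C).sub hi
  refine ⟨hi', ?_⟩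
  have h2 := integral_eq_lintegral_of_nonneg_ae hnn hm.aestronglyMeasurable
  rw [h, ENNReal.toReal_ofReal (sub_nonneg.2 (diskLogPotential_le_log (norm_nonneg x))),
    integral_sub (integrable_const C) hi'] at h2
  rw [integral_const, probReal_univ, one_smul] at h2
  linarith

lemma integrable_prod_circleLaw_log_norm_sub {ν : Measure Plane} [IsProbabilityMeasure ν]
    (hν : Integrable (fun x => ‖x‖ ^ 2) ν) :
    Integrable (fun p : Plane × Plane => Real.log ‖p.1 - p.2‖) (ν.prod circleLaw) := by
  have := isProbabilityMeasure_circleLaw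
  rw [integrable_prod_iff (Measurable.aestronglyMeasurable (by fun_prop))]
  have hi := fun x => (integral_circleLaw_log_norm_sub x).1
  simp only [norm_sub_rev _ (_ : Plane)] at hi ⊢
  refine ⟨.of_forall hi, ?_⟩
  refine Integrable.mono' (g := fun x => ‖x‖ ^ 2 + 3) (hν.add (integrable_const _)) ?_
    (.of_forall fun x => ?_)
  · exact (Measurable.stronglyMeasurable (by fun_prop)).integral_prod_right.aestronglyMeasurable
  · rw [Real.norm_of_nonneg (integral_nonneg fun _ => norm_nonneg _)]
    set C := Real.log (1 + ‖x‖)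
    have hC : C ≤ ‖x‖ := by
      have := Real.log_le_sub_one_of_pos (show 0 < 1 + ‖x‖ by positivity)
      linarith
    have hC0 : 0 ≤ C := Real.log_nonneg (by linarith [norm_nonneg x])
    have : ∫ y, ‖Real.log ‖x - y‖‖ ∂circleLaw ≤ ∫ y, (2 * C - Real.log ‖x - y‖) ∂circleLaw := by
      refine integral_mono_ae (hi x).norm ((integrable_const _).sub (hi x)) ?_
      filter_upwards [ae_circleLaw_norm_le_one] with y hy
      have := log_norm_sub_le_log_one_add (x := x) hy
      rw [norm_sub_rev] at this
      rw [Real.norm_eq_abs, abs_le]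
      constructor <;> linarith
    rw [integral_sub (integrable_const _) (hi x)] at this
    simp only [norm_sub_rev x _] at this ⊢
    rw [(integral_circleLaw_log_norm_sub x).2] at this
    rw [integral_const, probReal_univ, one_smul] at this
    nlinarith [neg_half_le_diskLogPotential (s := ‖x‖)]

lemma abs_exp_neg_sub_exp_neg_le {a b t : ℝ} (ht : 0 < t) :
    |t⁻¹ * (Real.exp (-(a * t)) - Real.exp (-(b * t)))| ≤ |a - b| * Real.exp (-(min a b * t)) := by
  wlog hab : a ≤ b generalizing a b
  · have := this (a := b) (b := a) (by linarith)
    rwa [min_comm, abs_sub_comm b a, ← abs_neg, ← mul_neg, neg_sub] at this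
  rw [min_eq_left hab, abs_sub_comm, abs_of_nonneg (sub_nonneg.2 hab), abs_of_nonneg]
  · have h1 : Real.exp (-(b * t)) = Real.exp (-(a * t)) * Real.exp (-((b - a) * t)) := by
      rw [← Real.exp_add]; ring_nf
    have h2 := Real.one_sub_le_exp_neg ((b - a) * t)
    rw [h1, inv_mul_le_iff₀ ht]
    nlinarith [Real.exp_pos (-(a * t))]
  · refine mul_nonneg (by positivity) (sub_nonneg.2 (Real.exp_le_exp.2 ?_))
    nlinarith

/-- The Gaussian decomposition of the logarithmic kernel. -/
lemma frullani_log {r : ℝ} (hr : 0 < r) :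
    IntegrableOn (fun t => t⁻¹ * (Real.exp (-(r ^ 2 * t)) - Real.exp (-t))) (Set.Ioi 0) ∧
    ∫ t in Set.Ioi 0, t⁻¹ * (Real.exp (-(r ^ 2 * t)) - Real.exp (-t)) = -2 * Real.log r := by
  have hi : IntegrableOn (fun t => t⁻¹ * (Real.exp (-(r ^ 2 * t)) - Real.exp (-t)))
      (Set.Ioi 0) := by
    have h0 : IntegrableOn (fun t => |r ^ 2 - 1| * Real.exp (-(min (r ^ 2) 1 * t)))
        (Set.Ioi 0) := by
      have := integrableOn_exp_mul_Ioi (a := -min (r ^ 2) 1) (by simp [hr]) 0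
      simp only [neg_mul] at this
      exact this.const_mul |r ^ 2 - 1|
    refine Integrable.mono' h0 (Measurable.aestronglyMeasurable (by fun_prop)) ?_
    filter_upwards [ae_restrict_mem measurableSet_Ioi] with t ht
    simpa using abs_exp_neg_sub_exp_neg_le (a := r ^ 2) (b := 1) ht
  refine ⟨hi, ?_⟩
  have hc : Continuous fun x : ℝ => Real.exp (-x) := by fun_prop
  have h0 : Tendsto (fun x : ℝ => Real.exp (-x)) (𝓝[>] 0) (𝓝 1) := by
    simpa using (hc.tendsto 0).mono_left nhdsWithin_le_nhds
  have := Frullani.integral_Ioi_eq (f := fun x => Real.exp (-x)) (a := r ^ 2) (b := 1)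
    (hc.locallyIntegrable.locallyIntegrableOn _) (by positivity) one_pos h0
    (Real.tendsto_exp_neg_atTop_nhds_zero) (by simpa using hi)
  simpa using this

lemma integral_abs_frullani_log {r : ℝ} (hr : 0 < r) :
    ∫ t in Set.Ioi 0, ‖t⁻¹ * (Real.exp (-(r ^ 2 * t)) - Real.exp (-t))‖ = 2 * |Real.log r| := by
  have h := (frullani_log hr).2
  rcases le_total r 1 with h1 | h1
  · rw [setIntegral_congr_fun (g := fun t => t⁻¹ * (Real.exp (-(r ^ 2 * t)) - Real.exp (-t)))
      measurableSet_Ioi, h, abs_of_nonpos (Real.log_nonpos hr.le h1)]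
    · ring
    · intro t ht
      have ht : 0 < t := ht
      refine Real.norm_of_nonneg (mul_nonneg (by positivity) (sub_nonneg.2 (Real.exp_le_exp.2 ?_)))
      have : r ^ 2 ≤ 1 := by nlinarith
      nlinarith
  · rw [setIntegral_congr_fun (g := fun t => -(t⁻¹ * (Real.exp (-(r ^ 2 * t)) - Real.exp (-t))))
      measurableSet_Ioi, integral_neg, h, abs_of_nonneg (Real.log_nonneg h1)]
    · ring
    · intro t ht
      have ht : 0 < t := ht
      refine Real.norm_of_nonpos (mul_nonpos_of_nonneg_of_nonpos (by positivity)
        (sub_nonpos.2 (Real.exp_le_exp.2 ?_)))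
      have : 1 ≤ r ^ 2 := by nlinarith
      nlinarith

/-- The mutual energy of two measures for the Gaussian kernel `exp (-t |x - y|²)`. -/
def gaussEnergy (t : ℝ) (ν μ : Measure Plane) : ℝ :=
  ∫ p, Real.exp (-(‖p.1 - p.2‖ ^ 2 * t)) ∂(ν.prod μ)

lemma integrable_exp_neg_norm_sub_sq {t : ℝ} (ht : 0 < t) (ν μ : Measure Plane)
    [IsProbabilityMeasure ν] [IsProbabilityMeasure μ] :
    Integrable (fun p : Plane × Plane => Real.exp (-(‖p.1 - p.2‖ ^ 2 * t))) (ν.prod μ) := by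
  refine Integrable.mono' (integrable_const 1) (Measurable.aestronglyMeasurable (by fun_prop))
    (.of_forall fun p => ?_)
  rw [Real.norm_of_nonneg (Real.exp_pos _).le, Real.exp_le_one_iff]
  have : 0 ≤ ‖p.1 - p.2‖ ^ 2 * t := by positivity
  linarith

/-- Fubini for the Gaussian decomposition of the logarithmic energy. -/
lemma integral_gaussEnergy {ν μ : Measure Plane} [IsProbabilityMeasure ν]
    [IsProbabilityMeasure μ] (hd : ∀ᵐ p ∂(ν.prod μ), p.1 ≠ p.2)
    (hi : Integrable (fun p : Plane × Plane => Real.log ‖p.1 - p.2‖) (ν.prod μ)) :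
    IntegrableOn (fun t => t⁻¹ * (gaussEnergy t ν μ - Real.exp (-t))) (Set.Ioi 0) ∧
    ∫ t in Set.Ioi 0, t⁻¹ * (gaussEnergy t ν μ - Real.exp (-t)) =
      -2 * ∫ p, Real.log ‖p.1 - p.2‖ ∂(ν.prod μ) := by
  have hF : Integrable (fun q : (Plane × Plane) × ℝ =>
      q.2⁻¹ * (Real.exp (-(‖q.1.1 - q.1.2‖ ^ 2 * q.2)) - Real.exp (-q.2)))
      ((ν.prod μ).prod (volume.restrict (Set.Ioi 0))) := by
    rw [integrable_prod_iff (Measurable.aestronglyMeasurable (by fun_prop))]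
    constructor
    · filter_upwards [hd] with p hp
      exact (frullani_log (norm_pos_iff.2 (sub_ne_zero.2 hp))).1
    · refine (hi.abs.const_mul 2).congr ?_
      filter_upwards [hd] with p hp
      exact (integral_abs_frullani_log (norm_pos_iff.2 (sub_ne_zero.2 hp))).symm
  have hE : ∀ t ∈ Set.Ioi (0 : ℝ),
      ∫ p : Plane × Plane, t⁻¹ * (Real.exp (-(‖p.1 - p.2‖ ^ 2 * t)) - Real.exp (-t)) ∂(ν.prod μ)
        = t⁻¹ * (gaussEnergy t ν μ - Real.exp (-t)) := by
    intro t ht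
    rw [integral_const_mul, integral_sub (integrable_exp_neg_norm_sub_sq ht ν μ)
      (integrable_const _)]
    simp [gaussEnergy]
  constructor
  · exact (integrableOn_congr_fun hE measurableSet_Ioi).1 hF.integral_prod_right
  · rw [← setIntegral_congr_fun measurableSet_Ioi hE, ← integral_integral_swap hF,
      ← integral_const_mul]
    refine integral_congr_ae ?_
    filter_upwards [hd] with p hp
    exact (frullani_log (norm_pos_iff.2 (sub_ne_zero.2 hp))).2

lemma gaussEnergy_comm (t : ℝ) (ν μ : Measure Plane) [SFinite ν] [SFinite μ] :
    gaussEnergy t ν μ = gaussEnergy t μ ν := by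
  rw [gaussEnergy, gaussEnergy, ← integral_prod_swap]
  simp only [Prod.fst_swap, Prod.snd_swap, norm_sub_rev]

open ProbabilityTheory ComplexConjugate in
lemma ofReal_gaussEnergy {t : ℝ} (ht : 0 < t) (ν μ : Measure Plane)
    [IsProbabilityMeasure ν] [IsProbabilityMeasure μ] :
    (gaussEnergy t ν μ : ℂ) = ∫ ξ, charFun ν (√(2 * t) • ξ) * conj (charFun μ (√(2 * t) • ξ))
      ∂(stdGaussian Plane) := by
  have h1 : ∀ p : Plane × Plane, ((Real.exp (-(‖p.1 - p.2‖ ^ 2 * t)) : ℝ) : ℂ) =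
      ∫ ξ, Complex.exp (inner ℝ p.1 (√(2 * t) • ξ) * Complex.I) *
        Complex.exp (inner ℝ p.2 (-(√(2 * t) • ξ)) * Complex.I) ∂(stdGaussian Plane) := by
    intro p
    have := charFun_stdGaussian (E := Plane) (√(2 * t) • (p.1 - p.2))
    rw [charFun_apply] at this
    rw [show Complex.exp (-(‖√(2 * t) • (p.1 - p.2)‖ : ℂ) ^ 2 / 2) =
      ((Real.exp (-(‖p.1 - p.2‖ ^ 2 * t)) : ℝ) : ℂ) by
        push_cast
        congr 1
        rw [norm_smul, Real.norm_of_nonneg (Real.sqrt_nonneg _), Complex.ofReal_mul, mul_pow,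
          ← Complex.ofReal_pow √(2 * t), Real.sq_sqrt (by positivity)]
        push_cast
        ring] at this
    rw [← this]
    congr 1
    ext ξ
    rw [← Complex.exp_add]
    congr 1
    rw [← add_mul, ← Complex.ofReal_add]
    congr 2
    rw [inner_neg_right, real_inner_smul_right, real_inner_smul_right, real_inner_smul_right,
      inner_sub_right, real_inner_comm ξ p.1, real_inner_comm ξ p.2]
    ring
  have h2 : ∀ ξ : Plane, charFun ν (√(2 * t) • ξ) * conj (charFun μ (√(2 * t) • ξ)) =
      ∫ p, Complex.exp (inner ℝ p.1 (√(2 * t) • ξ) * Complex.I) *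
        Complex.exp (inner ℝ p.2 (-(√(2 * t) • ξ)) * Complex.I) ∂(ν.prod μ) := by
    intro ξ
    rw [← charFun_neg, charFun_apply, charFun_apply, ← integral_prod_mul]
  simp only [h2]
  rw [gaussEnergy, ← integral_complex_ofReal, integral_congr_ae (.of_forall h1),
    integral_integral_swap]
  refine Integrable.mono' (integrable_const 1) (Measurable.aestronglyMeasurable ?_)
    (.of_forall fun p => ?_)
  · unfold Function.uncurry
    fun_prop
  · rw [Function.uncurry, norm_mul, Complex.norm_exp_ofReal_mul_I, Complex.norm_exp_ofReal_mul_I,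
      one_mul]

open ProbabilityTheory in
lemma gaussEnergy_sub_eq {t : ℝ} (ht : 0 < t) (ν μ : Measure Plane)
    [IsProbabilityMeasure ν] [IsProbabilityMeasure μ] :
    gaussEnergy t ν ν + gaussEnergy t μ μ - 2 * gaussEnergy t ν μ =
      ∫ ξ, ‖charFun ν (√(2 * t) • ξ) - charFun μ (√(2 * t) • ξ)‖ ^ 2 ∂(stdGaussian Plane) := by
  have hm : ∀ ν : Measure Plane, IsProbabilityMeasure ν →
      Continuous fun ξ : Plane => charFun ν (√(2 * t) • ξ) := by
    intro ν _
    exact continuous_charFun.comp (by fun_prop)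
  have hi : ∀ ν μ : Measure Plane, IsProbabilityMeasure ν → IsProbabilityMeasure μ →
      Integrable (fun ξ : Plane => charFun ν (√(2 * t) • ξ) *
        (starRingEnd ℂ) (charFun μ (√(2 * t) • ξ))) (stdGaussian Plane) := by
    intro ν μ hν hμ
    refine Integrable.mono' (integrable_const 1) (Continuous.aestronglyMeasurable ?_)
      (.of_forall fun ξ => ?_)
    · exact (hm ν hν).mul (Complex.continuous_conj.comp (hm μ hμ))
    · rw [norm_mul, RCLike.norm_conj]
      exact mul_le_one₀ (norm_charFun_le_one _) (norm_nonneg _) (norm_charFun_le_one _)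
  have hν : IsProbabilityMeasure ν := inferInstance
  have hμ : IsProbabilityMeasure μ := inferInstance
  apply Complex.ofReal_injective
  rw [← integral_complex_ofReal, two_mul]
  nth_rw 1 [gaussEnergy_comm t ν μ]
  push_cast
  rw [ofReal_gaussEnergy ht, ofReal_gaussEnergy ht, ofReal_gaussEnergy ht, ofReal_gaussEnergy ht,
    ← integral_add' (hi ν ν hν hν) (hi μ μ hμ hμ), ← integral_add' (hi μ ν hμ hν) (hi ν μ hν hμ),
    ← integral_sub' ((hi ν ν hν hν).add (hi μ μ hμ hμ)) ((hi μ ν hμ hν).add (hi ν μ hν hμ))]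
  congr 1
  ext ξ
  simp only [Pi.add_apply, Pi.sub_apply]
  rw [← Complex.mul_conj', map_sub]
  ring

open ProbabilityTheory in
instance isOpenPosMeasure_stdGaussian : (stdGaussian Plane).IsOpenPosMeasure := by
  have : (gaussianReal 0 1).IsOpenPosMeasure :=
    (gaussianReal_absolutelyContinuous' 0 one_ne_zero).isOpenPosMeasure
  rw [← map_pi_eq_stdGaussian]
  exact (PiLp.continuous_toLp 2 _).isOpenPosMeasure_map (WithLp.toLp_surjective 2)

lemma eq_of_gaussEnergy_sub_eq_zero {t : ℝ} (ht : 0 < t) {ν μ : Measure Plane}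
    [IsProbabilityMeasure ν] [IsProbabilityMeasure μ]
    (h : gaussEnergy t ν ν + gaussEnergy t μ μ - 2 * gaussEnergy t ν μ = 0) : ν = μ := by
  rw [gaussEnergy_sub_eq ht] at h
  have hc : Continuous fun ξ : Plane =>
      ‖charFun ν (√(2 * t) • ξ) - charFun μ (√(2 * t) • ξ)‖ ^ 2 :=
    (((continuous_charFun (μ := ν)).comp
        (by fun_prop : Continuous fun ξ : Plane => √(2 * t) • ξ)).sub
      ((continuous_charFun (μ := μ)).comp
        (by fun_prop : Continuous fun ξ : Plane => √(2 * t) • ξ))).norm.pow 2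
  rw [integral_eq_zero_iff_of_nonneg (fun _ => by positivity)] at h
  · have h0 := (hc.ae_eq_iff_eq _ (continuous_zero)).1 h
    refine Measure.ext_of_charFun (funext fun v => ?_)
    have := congrFun h0 ((√(2 * t))⁻¹ • v)
    have hs : √(2 * t) ≠ 0 := by positivity
    rw [smul_smul, mul_inv_cancel₀ hs, one_smul] at this
    exact sub_eq_zero.1 (norm_eq_zero.1 (sq_eq_zero_iff.1 this))
  · refine Integrable.mono' (integrable_const 4) hc.aestronglyMeasurable (.of_forall fun ξ => ?_)
    have h1 := norm_charFun_le_one (μ := ν) (√(2 * t) • ξ)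
    have h2 := norm_charFun_le_one (μ := μ) (√(2 * t) • ξ)
    have h3 := norm_sub_le (charFun ν (√(2 * t) • ξ)) (charFun μ (√(2 * t) • ξ))
    rw [Real.norm_of_nonneg (by positivity)]
    nlinarith [norm_nonneg (charFun ν (√(2 * t) • ξ) - charFun μ (√(2 * t) • ξ))]

/-- The logarithmic energy of a neutral difference of two probability measures is nonnegative and
vanishes only when they agree. -/
lemma log_energy_nonneg {ν μ : Measure Plane} [IsProbabilityMeasure ν] [IsProbabilityMeasure μ]
    (hdν : ∀ᵐ p ∂(ν.prod ν), p.1 ≠ p.2) (hdμ : ∀ᵐ p ∂(μ.prod μ), p.1 ≠ p.2)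
    (hd : ∀ᵐ p ∂(ν.prod μ), p.1 ≠ p.2)
    (hiν : Integrable (fun p : Plane × Plane => Real.log ‖p.1 - p.2‖) (ν.prod ν))
    (hiμ : Integrable (fun p : Plane × Plane => Real.log ‖p.1 - p.2‖) (μ.prod μ))
    (hi : Integrable (fun p : Plane × Plane => Real.log ‖p.1 - p.2‖) (ν.prod μ)) :
    0 ≤ 2 * (∫ p, Real.log ‖p.1 - p.2‖ ∂(ν.prod μ)) - (∫ p, Real.log ‖p.1 - p.2‖ ∂(ν.prod ν))
      - ∫ p, Real.log ‖p.1 - p.2‖ ∂(μ.prod μ) ∧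
    (2 * (∫ p, Real.log ‖p.1 - p.2‖ ∂(ν.prod μ)) - (∫ p, Real.log ‖p.1 - p.2‖ ∂(ν.prod ν))
      - (∫ p, Real.log ‖p.1 - p.2‖ ∂(μ.prod μ)) = 0 → ν = μ) := by
  obtain ⟨i1, e1⟩ := integral_gaussEnergy hdν hiν
  obtain ⟨i2, e2⟩ := integral_gaussEnergy hdμ hiμ
  obtain ⟨i3, e3⟩ := integral_gaussEnergy hd hi
  have i4 : IntegrableOn (fun t => t⁻¹ *
      (gaussEnergy t ν ν + gaussEnergy t μ μ - 2 * gaussEnergy t ν μ)) (Set.Ioi 0) := by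
    refine ((i1.add i2).sub (i3.const_mul 2)).congr (.of_forall fun t => ?_)
    simp only [Pi.add_apply, Pi.sub_apply]
    ring
  have e4 : ∫ t in Set.Ioi 0, t⁻¹ *
      (gaussEnergy t ν ν + gaussEnergy t μ μ - 2 * gaussEnergy t ν μ) =
      2 * (2 * (∫ p, Real.log ‖p.1 - p.2‖ ∂(ν.prod μ)) -
        (∫ p, Real.log ‖p.1 - p.2‖ ∂(ν.prod ν)) - ∫ p, Real.log ‖p.1 - p.2‖ ∂(μ.prod μ)) := by
    have h := integral_sub (i1.add i2) (i3.const_mul 2)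
    rw [integral_const_mul, integral_add' i1 i2, e1, e2, e3] at h
    rw [show 2 * (2 * (∫ p, Real.log ‖p.1 - p.2‖ ∂(ν.prod μ)) -
        (∫ p, Real.log ‖p.1 - p.2‖ ∂(ν.prod ν)) - ∫ p, Real.log ‖p.1 - p.2‖ ∂(μ.prod μ)) =
        -2 * (∫ p, Real.log ‖p.1 - p.2‖ ∂(ν.prod ν)) +
        -2 * (∫ p, Real.log ‖p.1 - p.2‖ ∂(μ.prod μ)) -
        2 * (-2 * (∫ p, Real.log ‖p.1 - p.2‖ ∂(ν.prod μ))) by ring, ← h]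
    congr 1
    ext t
    simp only [Pi.add_apply]
    ring
  have hnn : 0 ≤ᵐ[volume.restrict (Set.Ioi 0)] fun t => t⁻¹ *
      (gaussEnergy t ν ν + gaussEnergy t μ μ - 2 * gaussEnergy t ν μ) := by
    filter_upwards [ae_restrict_mem measurableSet_Ioi] with t ht
    rw [gaussEnergy_sub_eq ht]
    have ht : 0 < t := ht
    exact mul_nonneg (by positivity) (integral_nonneg fun _ => by positivity)
  have h0 := integral_nonneg_of_ae hnn
  refine ⟨by linarith, fun hz => ?_⟩
  rw [hz, mul_zero, integral_eq_zero_iff_of_nonneg_ae hnn i4] at e4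
  have : (ae (volume.restrict (Set.Ioi (0 : ℝ)))).NeBot := by
    rw [ae_neBot, Ne, Measure.restrict_eq_zero]
    simp
  obtain ⟨t, ht, htpos⟩ := (e4.and (ae_restrict_mem measurableSet_Ioi)).exists
  have htpos : 0 < t := htpos
  refine eq_of_gaussEnergy_sub_eq_zero htpos ?_
  simpa [htpos.ne'] using ht

lemma log_le_sq_div_eight_add_one {r : ℝ} (hr : 0 ≤ r) : Real.log r ≤ r ^ 2 / 8 + 1 := by
  rcases hr.eq_or_lt with rfl | hr
  · simp
  · have := Real.log_le_sub_one_of_pos (show 0 < r / 2 by positivity)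
    rw [Real.log_div hr.ne' two_ne_zero] at this
    have h2 := Real.log_two_lt_d9
    nlinarith [sq_nonneg (r - 2)]

lemma log_le_sq_div_four {r : ℝ} (hr : 0 ≤ r) : Real.log r ≤ r ^ 2 / 4 := by
  rcases hr.eq_or_lt with rfl | hr
  · simp
  · have := Real.log_le_sub_one_of_pos (show 0 < r ^ 2 / 2 by positivity)
    rw [Real.log_div (by positivity) two_ne_zero, Real.log_pow] at this
    have h2 := Real.log_two_lt_d9
    push_cast at this
    linarith

lemma norm_sub_sq_le (x y : Plane) : ‖x - y‖ ^ 2 ≤ 2 * (‖x‖ ^ 2 + ‖y‖ ^ 2) := by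
  nlinarith [norm_sub_le x y, norm_nonneg (x - y), sq_nonneg (‖x‖ - ‖y‖)]

/-- The real-valued interaction, symmetrized with the quadratic potential. -/
def pairEnergy (p : Plane × Plane) : ℝ :=
  -Real.log ‖p.1 - p.2‖ + (‖p.1‖ ^ 2 / 2 + ‖p.2‖ ^ 2 / 2)

lemma measurable_pairEnergy : Measurable pairEnergy := by
  unfold pairEnergy
  fun_prop

lemma pairEnergy_nonneg (p : Plane × Plane) : 0 ≤ pairEnergy p := by
  have := log_le_sq_div_four (norm_nonneg (p.1 - p.2))
  have := norm_sub_sq_le p.1 p.2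
  unfold pairEnergy
  linarith

lemma sq_add_sq_le_pairEnergy (p : Plane × Plane) :
    (‖p.1‖ ^ 2 + ‖p.2‖ ^ 2) ≤ 4 * (pairEnergy p + 1) := by
  have := log_le_sq_div_eight_add_one (norm_nonneg (p.1 - p.2))
  have := norm_sub_sq_le p.1 p.2
  unfold pairEnergy
  linarith

lemma Ilog2_eq_lintegral (ν : Measure Plane) :
    Ilog2 (fun x => ‖x‖ ^ 2) ν =
      ((∫⁻ p, (if p.1 = p.2 then ⊤ else ENNReal.ofReal (pairEnergy p)) ∂(ν.prod ν) : ℝ≥0∞) :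
        EReal) := by
  classical
  have hf : ∀ p : Plane × Plane, logK2 (p.1 - p.2) +
      ((‖p.1‖ ^ 2 / 2 + ‖p.2‖ ^ 2 / 2 : ℝ) : EReal) =
      if p.1 = p.2 then ⊤ else (pairEnergy p : EReal) := by
    intro p
    rw [logK2]
    simp only [sub_eq_zero]
    split_ifs
    · exact EReal.top_add_coe _
    · rw [← EReal.coe_add, pairEnergy]
  rw [Ilog2, eIntE]
  simp only [hf]
  have h1 : ∀ p : Plane × Plane, (if (if p.1 = p.2 then ⊤ else (pairEnergy p : EReal)) = ⊤ then ⊤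
      else ENNReal.ofReal (if p.1 = p.2 then ⊤ else (pairEnergy p : EReal)).toReal) =
      if p.1 = p.2 then ⊤ else ENNReal.ofReal (pairEnergy p) := by
    intro p
    split_ifs <;> simp_all
  have h2 : ∀ p : Plane × Plane, (if (if p.1 = p.2 then ⊤ else (pairEnergy p : EReal)) = ⊥ then ⊤
      else ENNReal.ofReal (-(if p.1 = p.2 then ⊤ else (pairEnergy p : EReal))).toReal) = 0 := by
    intro p
    have := pairEnergy_nonneg p
    split_ifs <;> simp_all
  simp only [h1, h2, lintegral_zero]
  simp

lemma Ilog2_eq_integral {ν : Measure Plane} (hd : ∀ᵐ p ∂(ν.prod ν), p.1 ≠ p.2)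
    (hi : Integrable pairEnergy (ν.prod ν)) :
    Ilog2 (fun x => ‖x‖ ^ 2) ν = ((∫ p, pairEnergy p ∂(ν.prod ν) : ℝ) : EReal) := by
  rw [Ilog2_eq_lintegral, lintegral_congr_ae (g := fun p => ENNReal.ofReal (pairEnergy p)),
    ← ofReal_integral_eq_lintegral_ofReal hi (.of_forall pairEnergy_nonneg),
    EReal.coe_ennreal_ofReal, max_eq_left (integral_nonneg pairEnergy_nonneg)]
  filter_upwards [hd] with p hp
  exact if_neg hp

lemma ae_ne_and_integrable_of_Ilog2_ne_top {ν : Measure Plane}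
    (h : Ilog2 (fun x => ‖x‖ ^ 2) ν ≠ ⊤) :
    (∀ᵐ p ∂(ν.prod ν), p.1 ≠ p.2) ∧ Integrable pairEnergy (ν.prod ν) := by
  classical
  rw [Ilog2_eq_lintegral, Ne, EReal.coe_ennreal_eq_top_iff] at h
  have hm : Measurable fun p : Plane × Plane =>
      if p.1 = p.2 then ⊤ else ENNReal.ofReal (pairEnergy p) :=
    Measurable.ite (measurableSet_eq_fun measurable_fst measurable_snd) measurable_const
      measurable_pairEnergy.ennreal_ofReal
  constructor
  · filter_upwards [ae_lt_top hm h] with p hp heq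
    simp [heq] at hp
  · refine (lintegral_ofReal_ne_top_iff_integrable measurable_pairEnergy.aestronglyMeasurable
      (.of_forall pairEnergy_nonneg)).1 (ne_top_of_le_ne_top h (lintegral_mono fun p => ?_))
    dsimp only
    split_ifs
    · exact le_top
    · rfl

lemma integrable_norm_sq_of_integrable_pairEnergy {ν : Measure Plane} [IsProbabilityMeasure ν]
    (h : Integrable pairEnergy (ν.prod ν)) : Integrable (fun x => ‖x‖ ^ 2) ν := by
  have : Integrable (fun p : Plane × Plane => ‖p.1‖ ^ 2) (ν.prod ν) := by
    refine Integrable.mono' ((h.add (integrable_const 1)).const_mul 4)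
      (Measurable.aestronglyMeasurable (by fun_prop)) (.of_forall fun p => ?_)
    rw [Real.norm_of_nonneg (by positivity)]
    have := sq_add_sq_le_pairEnergy p
    simp only [Pi.add_apply]
    nlinarith [sq_nonneg ‖p.2‖]
  exact this.of_comp_fst (NeZero.ne ν)

lemma integrable_pairEnergy_iff {ν : Measure Plane} [IsProbabilityMeasure ν]
    (h2 : Integrable (fun x => ‖x‖ ^ 2) ν) :
    Integrable pairEnergy (ν.prod ν) ↔
      Integrable (fun p : Plane × Plane => Real.log ‖p.1 - p.2‖) (ν.prod ν) := by
  have hV : Integrable (fun p : Plane × Plane => ‖p.1‖ ^ 2 / 2 + ‖p.2‖ ^ 2 / 2) (ν.prod ν) :=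
    ((h2.div_const 2).comp_fst ν).add ((h2.div_const 2).comp_snd ν)
  constructor
  · intro h
    refine (hV.sub h).congr (.of_forall fun p => ?_)
    simp [pairEnergy]
  · intro h
    exact h.neg.add hV

lemma integral_pairEnergy {ν : Measure Plane} [IsProbabilityMeasure ν]
    (h2 : Integrable (fun x => ‖x‖ ^ 2) ν)
    (hi : Integrable (fun p : Plane × Plane => Real.log ‖p.1 - p.2‖) (ν.prod ν)) :
    ∫ p, pairEnergy p ∂(ν.prod ν) =
      -(∫ p, Real.log ‖p.1 - p.2‖ ∂(ν.prod ν)) + ∫ x, ‖x‖ ^ 2 ∂ν := by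
  have h1 := (h2.div_const 2).comp_fst ν
  have h1' := (h2.div_const 2).comp_snd ν
  have e1 : ∫ p : Plane × Plane, ‖p.1‖ ^ 2 / 2 ∂(ν.prod ν) = (∫ x, ‖x‖ ^ 2 ∂ν) / 2 := by
    rw [integral_fun_fst (μ := ν) (ν := ν) (fun x : Plane => ‖x‖ ^ 2 / 2), integral_div]
    simp
  have e2 : ∫ p : Plane × Plane, ‖p.2‖ ^ 2 / 2 ∂(ν.prod ν) = (∫ x, ‖x‖ ^ 2 ∂ν) / 2 := by
    rw [integral_fun_snd (μ := ν) (ν := ν) (fun x : Plane => ‖x‖ ^ 2 / 2), integral_div]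
    simp
  have hV : Integrable (fun p : Plane × Plane => ‖p.1‖ ^ 2 / 2 + ‖p.2‖ ^ 2 / 2) (ν.prod ν) :=
    h1.add h1'
  have hneg : Integrable (fun p : Plane × Plane => -Real.log ‖p.1 - p.2‖) (ν.prod ν) := hi.neg
  unfold pairEnergy
  rw [integral_add hneg hV, integral_add h1 h1', e1, e2, integral_neg]
  ring

lemma ae_prod_circleLaw_ne (ν : Measure Plane) [IsProbabilityMeasure ν] :
    ∀ᵐ p ∂(ν.prod circleLaw), p.1 ≠ p.2 := by
  have := isProbabilityMeasure_circleLaw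
  have hm : MeasurableSet {p : Plane × Plane | p.1 ≠ p.2} :=
    (measurableSet_eq_fun measurable_fst measurable_snd).compl
  rw [Measure.ae_prod_iff_ae_ae hm]
  refine .of_forall fun x => ?_
  refine Measure.ae_smul_measure (ae_restrict_of_ae ?_) _
  filter_upwards [Measure.ae_ne volume x] with y hy
  exact hy.symm

lemma integrable_norm_sq_circleLaw : Integrable (fun x => ‖x‖ ^ 2) circleLaw := by
  have := isProbabilityMeasure_circleLaw
  refine Integrable.mono' (integrable_const 1) (Measurable.aestronglyMeasurable (by fun_prop)) ?_
  filter_upwards [ae_circleLaw_norm_le_one] with x hx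
  rw [Real.norm_of_nonneg (by positivity)]
  nlinarith [norm_nonneg x]

lemma integral_prod_circleLaw_log_norm_sub {ν : Measure Plane} [IsProbabilityMeasure ν]
    (h2 : Integrable (fun x => ‖x‖ ^ 2) ν) :
    Integrable (fun x => diskLogPotential ‖x‖) ν ∧
    ∫ p, Real.log ‖p.1 - p.2‖ ∂(ν.prod circleLaw) = ∫ x, diskLogPotential ‖x‖ ∂ν := by
  have := isProbabilityMeasure_circleLaw
  have hi := integrable_prod_circleLaw_log_norm_sub h2
  have h := fun x => (integral_circleLaw_log_norm_sub x).2
  simp only [norm_sub_rev _ (_ : Plane)] at h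
  refine ⟨hi.integral_prod_left.congr (.of_forall h), ?_⟩
  rw [integral_prod _ hi]
  exact integral_congr_ae (.of_forall h)

lemma integral_prod_circleLaw_log_norm_sub_le {ν : Measure Plane} [IsProbabilityMeasure ν]
    (h2 : Integrable (fun x => ‖x‖ ^ 2) ν) :
    ∫ p, Real.log ‖p.1 - p.2‖ ∂(ν.prod circleLaw) ≤ ((∫ x, ‖x‖ ^ 2 ∂ν) - 1) / 2 := by
  obtain ⟨hi, he⟩ := integral_prod_circleLaw_log_norm_sub h2
  rw [he]
  refine (integral_mono hi ((h2.sub (integrable_const 1)).div_const 2)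
    fun x => diskLogPotential_le_sq (norm_nonneg x)).trans_eq ?_
  simp only [Pi.sub_apply]
  rw [integral_div, integral_sub h2 (integrable_const 1)]
  simp

lemma integral_circleLaw_prod_circleLaw_log_norm_sub :
    ∫ p, Real.log ‖p.1 - p.2‖ ∂(circleLaw.prod circleLaw) =
      ((∫ x, ‖x‖ ^ 2 ∂circleLaw) - 1) / 2 := by
  have := isProbabilityMeasure_circleLaw
  have h2 := integrable_norm_sq_circleLaw
  have h3 := integral_sub h2 (integrable_const 1)
  rw [integral_const, probReal_univ, one_smul] at h3
  rw [(integral_prod_circleLaw_log_norm_sub h2).2, ← h3, ← integral_div]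
  refine integral_congr_ae ?_
  filter_upwards [ae_circleLaw_norm_le_one] with x hx
  exact if_pos hx

lemma circleLaw_minimizes {ν : Measure Plane} [IsProbabilityMeasure ν]
    (h : Ilog2 (fun x => ‖x‖ ^ 2) ν ≠ ⊤) :
    Ilog2 (fun x => ‖x‖ ^ 2) circleLaw ≤ Ilog2 (fun x => ‖x‖ ^ 2) ν ∧
    (Ilog2 (fun x => ‖x‖ ^ 2) ν = Ilog2 (fun x => ‖x‖ ^ 2) circleLaw → ν = circleLaw) := by
  have := isProbabilityMeasure_circleLaw
  have h2μ := integrable_norm_sq_circleLaw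
  have hiμ := integrable_prod_circleLaw_log_norm_sub h2μ
  have hdμ := ae_prod_circleLaw_ne circleLaw
  obtain ⟨hdν, hW⟩ := ae_ne_and_integrable_of_Ilog2_ne_top h
  have h2ν := integrable_norm_sq_of_integrable_pairEnergy hW
  have hiν := (integrable_pairEnergy_iff h2ν).1 hW
  obtain ⟨hpos, heq⟩ := log_energy_nonneg hdν hdμ (ae_prod_circleLaw_ne ν) hiν hiμ
    (integrable_prod_circleLaw_log_norm_sub h2ν)
  have hle := integral_prod_circleLaw_log_norm_sub_le h2ν
  have hμ := integral_circleLaw_prod_circleLaw_log_norm_sub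
  rw [Ilog2_eq_integral hdν hW, Ilog2_eq_integral hdμ ((integrable_pairEnergy_iff h2μ).2 hiμ),
    integral_pairEnergy h2ν hiν, integral_pairEnergy h2μ hiμ, EReal.coe_le_coe_iff,
    EReal.coe_eq_coe_iff]
  exact ⟨by linarith, fun h => heq (by linarith)⟩

lemma Ilog2_circleLaw_ne_top : Ilog2 (fun x => ‖x‖ ^ 2) circleLaw ≠ ⊤ := by
  have := isProbabilityMeasure_circleLaw
  have h2μ := integrable_norm_sq_circleLaw
  rw [Ilog2_eq_integral (ae_prod_circleLaw_ne circleLaw)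
    ((integrable_pairEnergy_iff h2μ).2 (integrable_prod_circleLaw_log_norm_sub h2μ))]
  exact EReal.coe_ne_top _

/-- for `g(x) = -log|x|` on `ℝ²` and `V(x) = |x|²`, the normalized Lebesgue
measure on the unit disk is the unique minimizer of `I_V` over Borel probability measures. -/
theorem statement_2 :
    IsProbabilityMeasure circleLaw ∧
    (∀ ν : Measure Plane, IsProbabilityMeasure ν →
      Ilog2 (fun x => ‖x‖ ^ 2) circleLaw ≤ Ilog2 (fun x => ‖x‖ ^ 2) ν) ∧
    (∀ ν : Measure Plane, IsProbabilityMeasure ν →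
      Ilog2 (fun x => ‖x‖ ^ 2) ν = Ilog2 (fun x => ‖x‖ ^ 2) circleLaw → ν = circleLaw) := by
  refine ⟨isProbabilityMeasure_circleLaw, fun ν _ => ?_, fun ν _ h => ?_⟩
  · by_cases h : Ilog2 (fun x => ‖x‖ ^ 2) ν = ⊤
    · exact h ▸ le_top
    · exact (circleLaw_minimizes h).1
  · exact (circleLaw_minimizes (h ▸ Ilog2_circleLaw_ne_top)).2 h
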